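/- arXiv:2004.01157 — 10 statements merged into one kernel-verified Lean document; each statement's English description precedes it below -/
import Mathlib

section
/- Let G be a directed acyclic graph on disjoint finite vertex sets V (observed) and H (hidden), let Y* ⊆ V, and let Markov kernels p_v be given for all vertices. Then for every joint assignment x, the latent-variable factorization of the interventional distribution factorizes by districts: the sum over all reassignments of H of the product, over v ∈ H ∪ Y*, of p_v equals the product, over all districts D of Y*, of the sum over all reassignments of H of the product, over v ∈ D ∪ H, of p_v. (This is the computational core of the soundness theorem for the ID algorithm: p(Y* | do(V \ Y*)) = ∏_{D ∈ 𝒟} φ_{V\D}(p(V)).) -/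
open Finset
open scoped Classical

section Setup

variable {ι : Type*} [Fintype ι] [DecidableEq ι]

/-- The set of joint assignments agreeing with `x` outside `S`. -/
noncomputable def reassign (X : ι → Type*) [∀ i, Fintype (X i)]
    (S : Finset ι) (x : ∀ i, X i) : Finset (∀ i, X i) :=
  Finset.univ.filter fun y => ∀ i ∉ S, y i = x i

variable (E : ι → ι → Prop) (H : Finset ι)

/-- There is a hidden-directed path from `h` to `v`: a directed path all of whose
vertices other than the final endpoint `v` lie in `H`. -/
def HPath (h v : ι) : Prop :=
  Relation.TransGen (fun a b => E a b ∧ a ∈ H) h v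

/-- `H_D`: hidden vertices with a hidden-directed path into `D`. -/
noncomputable def hiddenInto (D : Finset ι) : Finset ι :=
  H.filter fun h => ∃ d ∈ D, HPath E H h d

/-- `y ≈ y'`: some hidden vertex has hidden-directed paths to both. -/
def DistrictRel (y y' : ι) : Prop :=
  ∃ h, HPath E H h y ∧ HPath E H h y'

variable (Ystar : Finset ι)

/-- The districts of `Ystar`: equivalence classes of `Ystar` under the restriction to
`Ystar` of the equivalence relation generated by `DistrictRel`. -/
noncomputable def districts : Finset (Finset ι) :=
  Ystar.image fun y => Ystar.filter fun y' => Relation.EqvGen (DistrictRel E H) y y'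

/-- `H*`: the union of `H_D` over all districts `D` of `Ystar`. -/
noncomputable def HstarSet : Finset ι :=
  (districts E H Ystar).biUnion fun D => hiddenInto E H D

/-- Parents of a set of vertices: `pa(S) = ⋃_{s ∈ S} {u : u → s}`. -/
noncomputable def parentsOf (S : Finset ι) : Finset ι :=
  Finset.univ.filter fun u => ∃ s ∈ S, E u s

end Setup

section Helpers

variable {ι : Type*} [Fintype ι] [DecidableEq ι] {X : ι → Type*} [∀ i, Fintype (X i)]

lemma mem_reassign {S : Finset ι} {x y : ∀ i, X i} :
    y ∈ reassign X S x ↔ ∀ i ∉ S, y i = x i := by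
  simp [reassign]

lemma sum_reassign_union {S T : Finset ι} (hST : Disjoint S T) (x : ∀ i, X i)
    (F : (∀ i, X i) → ℝ) :
    ∑ z ∈ reassign X (S ∪ T) x, F z
      = ∑ y ∈ reassign X S x, ∑ z ∈ reassign X T y, F z := by
  have hd : ∀ i, i ∈ S → i ∉ T := fun i hi => Finset.disjoint_left.1 hST hi
  rw [← Finset.sum_fiberwise_of_maps_to (t := reassign X S x)
    (g := fun z i => if i ∈ S then z i else x i)]
  · refine Finset.sum_congr rfl fun y hy => Finset.sum_congr ?_ fun _ _ => rfl
    rw [mem_reassign] at hy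
    ext z
    rw [Finset.mem_filter, mem_reassign, mem_reassign]
    constructor
    · rintro ⟨h1, h2⟩ i hi
      by_cases hS : i ∈ S
      · have := congrFun h2 i
        simpa [hS] using this
      · rw [h1 i (by simp [hS, hi]), hy i hS]
    · intro h
      constructor
      · intro i hi
        rw [Finset.mem_union, not_or] at hi
        rw [h i hi.2, hy i hi.1]
      · funext i
        by_cases hS : i ∈ S
        · simpa [hS] using h i (hd i hS)
        · simp [hS, hy i hS]
  · intro z _
    rw [mem_reassign]
    intro i hi
    simp [hi]

lemma sum_reassign_single (h : ι) (x : ∀ i, X i) (F : (∀ i, X i) → ℝ) :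
    ∑ z ∈ reassign X {h} x, F z = ∑ s : X h, F (Function.update x h s) := by
  symm
  refine Finset.sum_bij (fun s _ => Function.update x h s) ?_ ?_ ?_ ?_
  · intro s _
    rw [mem_reassign]
    intro i hi
    exact Function.update_of_ne (by simpa using hi) _ _
  · intro a _ b _ hab
    exact Function.update_injective x h hab
  · intro z hz
    rw [mem_reassign] at hz
    refine ⟨z h, Finset.mem_univ _, ?_⟩
    funext i
    by_cases hi : i = h
    · subst hi; simp
    · rw [Function.update_of_ne hi, hz i (by simpa using hi)]
  · intros; rfl

/-- `F` does not depend on the coordinates in `S`. -/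
def Indep (S : Finset ι) (F : (∀ i, X i) → ℝ) : Prop :=
  ∀ x y : ∀ i, X i, (∀ i ∉ S, x i = y i) → F x = F y

lemma sum_reassign_indep {S T : Finset ι} (hST : Disjoint S T) {x y : ∀ i, X i}
    {G : (∀ i, X i) → ℝ} (hG : Indep S G) (hy : y ∈ reassign X S x) :
    ∑ z ∈ reassign X T y, G z = ∑ z ∈ reassign X T x, G z := by
  have hd : ∀ i, i ∈ T → i ∉ S := fun i hi => Finset.disjoint_right.1 hST hi
  rw [mem_reassign] at hy
  refine Finset.sum_bij' (fun z _ i => if i ∈ T then z i else x i)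
    (fun z _ i => if i ∈ T then z i else y i) ?_ ?_ ?_ ?_ ?_
  · intro z _
    rw [mem_reassign]
    intro i hi
    simp [hi]
  · intro z _
    rw [mem_reassign]
    intro i hi
    simp [hi]
  · intro z hz
    rw [mem_reassign] at hz
    funext i
    by_cases hi : i ∈ T
    · simp [hi]
    · simp [hi, hz i hi]
  · intro z hz
    rw [mem_reassign] at hz
    funext i
    by_cases hi : i ∈ T
    · simp [hi]
    · simp [hi, hz i hi]
  · intro z hz
    rw [mem_reassign] at hz
    apply hG
    intro i hi
    by_cases hT : i ∈ T
    · simp [hT]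
    · simp [hT, hz i hT, hy i hi]

lemma sum_reassign_mul {S T : Finset ι} (hST : Disjoint S T) (x : ∀ i, X i)
    {F G : (∀ i, X i) → ℝ} (hF : Indep T F) (hG : Indep S G) :
    ∑ z ∈ reassign X (S ∪ T) x, F z * G z
      = (∑ z ∈ reassign X S x, F z) * ∑ z ∈ reassign X T x, G z := by
  rw [sum_reassign_union hST, Finset.sum_mul]
  refine Finset.sum_congr rfl fun y hy => ?_
  rw [← sum_reassign_indep hST hG hy, Finset.mul_sum]
  refine Finset.sum_congr rfl fun z hz => ?_
  rw [hF z y (mem_reassign.1 hz)]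

variable {E : ι → ι → Prop} {p : ι → (∀ i, X i) → ℝ}

lemma indep_prod
    (hploc : ∀ v (x y : ∀ i, X i), x v = y v → (∀ u, E u v → x u = y u) → p v x = p v y)
    {A S : Finset ι} (hd : ∀ a ∈ A, a ∉ S) (hE : ∀ a ∈ A, ∀ u, E u a → u ∉ S) :
    Indep S (fun x : ∀ i, X i => ∏ v ∈ A, p v x) := by
  intro x y h
  refine Finset.prod_congr rfl fun v hv => hploc v x y (h v (hd v hv)) fun u hu => ?_
  exact h u (hE v hv u hu)

lemma exists_sink (hacyc : ∀ v, ¬ Relation.TransGen E v v) (S : Finset ι) (hS : S.Nonempty) :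
    ∃ h ∈ S, ∀ a ∈ S, ¬ E h a := by
  have : Std.Irrefl (Relation.TransGen E) := ⟨hacyc⟩
  have hwf : WellFounded (Function.swap (Relation.TransGen E)) :=
    Finite.wellFounded_of_trans_of_irrefl _
  obtain ⟨m, hm, h⟩ := hwf.has_min (S : Set ι) hS
  exact ⟨m, hm, fun a ha hE => h a ha (Relation.TransGen.single hE)⟩

lemma marginalize (hacyc : ∀ v, ¬ Relation.TransGen E v v)
    (hploc : ∀ v (x y : ∀ i, X i), x v = y v → (∀ u, E u v → x u = y u) → p v x = p v y)
    (hpnorm : ∀ v (x : ∀ i, X i), ∑ s : X v, p v (Function.update x v s) = 1)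
    (D T : Finset ι) (x : ∀ i, X i) (n : ℕ) :
    ∀ R : Finset ι, R.card = n → Disjoint R T → Disjoint R D →
      (∀ h ∈ R, ∀ a ∈ D ∪ T, ¬ E h a) →
      ∑ y ∈ reassign X (T ∪ R) x, ∏ v ∈ D ∪ (T ∪ R), p v y
        = ∑ y ∈ reassign X T x, ∏ v ∈ D ∪ T, p v y := by
  induction n with
  | zero =>
    intro R hR _ _ _
    rw [Finset.card_eq_zero] at hR
    subst hR
    simp
  | succ n ih =>
    intro R hR hRT hRD hE
    obtain ⟨h, hhR, hsink⟩ := exists_sink hacyc R (Finset.card_pos.1 (by omega))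
    have hhT : h ∉ T := Finset.disjoint_left.1 hRT hhR
    have hhD : h ∉ D := Finset.disjoint_left.1 hRD hhR
    have hsub : R.erase h ⊆ R := Finset.erase_subset _ _
    rw [← ih (R.erase h) (by rw [Finset.card_erase_of_mem hhR]; omega)
      (hRT.mono_left hsub) (hRD.mono_left hsub) (fun a ha => hE a (hsub ha))]
    have e1 : T ∪ R = (T ∪ R.erase h) ∪ {h} := by
      ext i; by_cases hi : i = h <;> simp [hi, hhR]
    have e2 : D ∪ (T ∪ R) = insert h (D ∪ (T ∪ R.erase h)) := by
      ext i; by_cases hi : i = h <;> simp [hi, hhR]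
    have hnot : h ∉ D ∪ (T ∪ R.erase h) := by simp [hhT, hhD]
    rw [e2, e1, sum_reassign_union (by simp [hhT])]
    refine Finset.sum_congr rfl fun y _ => ?_
    have hind : Indep {h} (fun x : ∀ i, X i => ∏ v ∈ D ∪ (T ∪ R.erase h), p v x) := by
      apply indep_prod hploc
      · intro a ha hah
        rw [Finset.mem_singleton] at hah
        exact hnot (hah ▸ ha)
      · intro a ha u hu huh
        rw [Finset.mem_singleton] at huh
        subst huh
        rcases Finset.mem_union.1 ha with ha | ha
        · exact hE u hhR a (Finset.mem_union_left _ ha) hu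
        rcases Finset.mem_union.1 ha with ha | ha
        · exact hE u hhR a (Finset.mem_union_right _ ha) hu
        · exact hsink a (hsub ha) hu
    calc _ = ∑ z ∈ reassign X {h} y, p h z * ∏ v ∈ D ∪ (T ∪ R.erase h), p v y := by
          refine Finset.sum_congr rfl fun z hz => ?_
          rw [Finset.prod_insert hnot]
          congr 1
          exact hind z y (mem_reassign.1 hz)
      _ = _ := by
          rw [← Finset.sum_mul, sum_reassign_single, hpnorm, one_mul]

variable (E p) in
/-- The reduced district factor. -/
noncomputable def ZZ (H : Finset ι) (x : ∀ i, X i) (D : Finset ι) : ℝ :=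
  ∑ y ∈ reassign X (hiddenInto E H D) x, ∏ v ∈ D ∪ hiddenInto E H D, p v y

lemma parent_mem {H D : Finset ι} {u a : ι} (ha : a ∈ D ∪ hiddenInto E H D) (hu : E u a)
    (hH : u ∈ H) : u ∈ hiddenInto E H D := by
  rw [hiddenInto, Finset.mem_filter]
  refine ⟨hH, ?_⟩
  rcases Finset.mem_union.1 ha with ha | ha
  · exact ⟨a, ha, Relation.TransGen.single ⟨hu, hH⟩⟩
  · obtain ⟨_, d, hd, hp⟩ := Finset.mem_filter.1 ha
    exact ⟨d, hd, Relation.TransGen.head ⟨hu, hH⟩ hp⟩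

lemma sum_eq_ZZ (hacyc : ∀ v, ¬ Relation.TransGen E v v)
    (hploc : ∀ v (x y : ∀ i, X i), x v = y v → (∀ u, E u v → x u = y u) → p v x = p v y)
    (hpnorm : ∀ v (x : ∀ i, X i), ∑ s : X v, p v (Function.update x v s) = 1)
    (H D : Finset ι) (hD : Disjoint D H) (x : ∀ i, X i) :
    ∑ y ∈ reassign X H x, ∏ v ∈ D ∪ H, p v y = ZZ E p H x D := by
  have h := marginalize hacyc hploc hpnorm D (hiddenInto E H D) x _
    (H \ hiddenInto E H D) rfl Finset.sdiff_disjoint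
    (hD.symm.mono_left Finset.sdiff_subset) (by
      intro h hh a ha hE
      rw [Finset.mem_sdiff] at hh
      exact hh.2 (parent_mem ha hE hh.1))
  rw [Finset.union_sdiff_of_subset (show hiddenInto E H D ⊆ H from Finset.filter_subset _ _)] at h
  exact h

lemma ZZ_union
    (hploc : ∀ v (x y : ∀ i, X i), x v = y v → (∀ u, E u v → x u = y u) → p v x = p v y)
    {H D D' : Finset ι} (hD : Disjoint D H) (hD' : Disjoint D' H) (hDD : Disjoint D D')
    (hh : Disjoint (hiddenInto E H D) (hiddenInto E H D')) (x : ∀ i, X i) :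
    ZZ E p H x (D ∪ D') = ZZ E p H x D * ZZ E p H x D' := by
  have e : hiddenInto E H (D ∪ D') = hiddenInto E H D ∪ hiddenInto E H D' := by
    ext i
    simp only [hiddenInto, Finset.mem_filter, Finset.mem_union]
    grind
  have s1 : ∀ A, hiddenInto E H A ⊆ H := fun A => Finset.filter_subset _ _
  have hind : ∀ A B : Finset ι, Disjoint A H →
      Disjoint (hiddenInto E H A) (hiddenInto E H B) →
      Indep (hiddenInto E H B) (fun x : ∀ i, X i => ∏ v ∈ A ∪ hiddenInto E H A, p v x) := by
    intro A B hA hAB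
    apply indep_prod hploc
    · intro a ha hb
      rcases Finset.mem_union.1 ha with ha | ha
      · exact Finset.disjoint_left.1 hA ha (s1 _ hb)
      · exact Finset.disjoint_left.1 hAB ha hb
    · intro a ha u hu hb
      exact Finset.disjoint_left.1 hAB (parent_mem ha hu (s1 _ hb)) hb
  unfold ZZ
  rw [← sum_reassign_mul hh x (hind D D' hD hh) (hind D' D hD' hh.symm), e]
  refine Finset.sum_congr rfl fun y _ => ?_
  rw [← Finset.prod_union, Finset.union_union_union_comm]
  rw [Finset.disjoint_union_left, Finset.disjoint_union_right, Finset.disjoint_union_right]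
  exact ⟨⟨hDD, hD.mono_right (s1 _)⟩, (hD'.mono_right (s1 _)).symm, hh⟩

lemma ZZ_biUnion
    (hploc : ∀ v (x y : ∀ i, X i), x v = y v → (∀ u, E u v → x u = y u) → p v x = p v y)
    {H : Finset ι} (x : ∀ i, X i) (P : Finset (Finset ι))
    (h1 : ∀ D ∈ P, Disjoint D H)
    (h2 : ∀ D ∈ P, ∀ D' ∈ P, D ≠ D' → Disjoint D D')
    (h3 : ∀ D ∈ P, ∀ D' ∈ P, D ≠ D' → Disjoint (hiddenInto E H D) (hiddenInto E H D')) :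
    ZZ E p H x (P.biUnion id) = ∏ D ∈ P, ZZ E p H x D := by
  induction P using Finset.induction_on with
  | empty =>
    have e : reassign X (∅ : Finset ι) x = {x} := by
      ext y
      rw [mem_reassign, Finset.mem_singleton]
      simp [funext_iff]
    have e' : hiddenInto E H ∅ = ∅ := by simp [hiddenInto]
    simp [ZZ, e, e']
  | insert D P hDP ih =>
    have hm : ∀ A ∈ P, A ∈ insert D P := fun A => Finset.mem_insert_of_mem
    have hDm : D ∈ insert D P := Finset.mem_insert_self _ _
    have hne : ∀ A ∈ P, D ≠ A := fun A hA h => hDP (h ▸ hA)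
    rw [Finset.prod_insert hDP, Finset.biUnion_insert, id, ZZ_union hploc (h1 D hDm), ih]
    · exact fun A hA => h1 A (hm A hA)
    · exact fun A hA B hB => h2 A (hm A hA) B (hm B hB)
    · exact fun A hA B hB => h3 A (hm A hA) B (hm B hB)
    · rw [Finset.disjoint_biUnion_left]
      exact fun A hA => h1 A (hm A hA)
    · rw [Finset.disjoint_biUnion_right]
      exact fun A hA => h2 D hDm A (hm A hA) (hne A hA)
    · rw [Finset.disjoint_left]
      intro h hh hh'
      obtain ⟨hH, d, hd, hp⟩ := Finset.mem_filter.1 hh'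
      obtain ⟨A, hA, hdA⟩ := Finset.mem_biUnion.1 hd
      exact Finset.disjoint_left.1 (h3 D hDm A (hm A hA) (hne A hA)) hh
        (Finset.mem_filter.2 ⟨hH, d, hdA, hp⟩)

lemma districts_eq {H Y D D' : Finset ι} (hD : D ∈ districts E H Y) (hD' : D' ∈ districts E H Y)
    {a b : ι} (ha : a ∈ D) (hb : b ∈ D') (hab : Relation.EqvGen (DistrictRel E H) a b) :
    D = D' := by
  obtain ⟨y, _, rfl⟩ := Finset.mem_image.1 hD
  obtain ⟨y', _, rfl⟩ := Finset.mem_image.1 hD'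
  have ha := (Finset.mem_filter.1 ha).2
  have hb := (Finset.mem_filter.1 hb).2
  have hy : Relation.EqvGen (DistrictRel E H) y y' :=
    (ha.trans _ _ _ hab).trans _ _ _ (hb.symm _ _)
  ext z
  simp only [Finset.mem_filter]
  exact and_congr_right fun _ =>
    ⟨fun h => (hy.symm _ _).trans _ _ _ h, fun h => hy.trans _ _ _ h⟩

end Helpers

/-- Soundness core of the ID algorithm: the latent-variable factorization of the
interventional distribution factorizes by districts. -/
theorem district_factorization
    {ι : Type*} [Fintype ι] [DecidableEq ι]
    (E : ι → ι → Prop) (V H : Finset ι)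
    (hdisj : Disjoint V H) (hcover : V ∪ H = Finset.univ)
    (hacyc : ∀ v, ¬ Relation.TransGen E v v)
    (Ystar : Finset ι) (hY : Ystar ⊆ V)
    (X : ι → Type*) [∀ i, Fintype (X i)] [∀ i, Nonempty (X i)]
    (p : ι → (∀ i, X i) → ℝ)
    (hp0 : ∀ v x, 0 ≤ p v x)
    (hploc : ∀ v (x y : ∀ i, X i), x v = y v → (∀ u, E u v → x u = y u) → p v x = p v y)
    (hpnorm : ∀ v (x : ∀ i, X i), ∑ s : X v, p v (Function.update x v s) = 1) :
    ∀ x : ∀ i, X i,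
      ∑ y ∈ reassign X H x, ∏ v ∈ H ∪ Ystar, p v y
        = ∏ D ∈ districts E H Ystar, ∑ y ∈ reassign X H x, ∏ v ∈ D ∪ H, p v y := by
  intro x
  have hYH : Disjoint Ystar H := hdisj.mono_left hY
  have hsub : ∀ D ∈ districts E H Ystar, D ⊆ Ystar := by
    intro D hD
    obtain ⟨y, _, rfl⟩ := Finset.mem_image.1 hD
    exact Finset.filter_subset _ _
  have hU : (districts E H Ystar).biUnion id = Ystar := by
    ext y
    rw [Finset.mem_biUnion]
    constructor
    · rintro ⟨D, hD, hy⟩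
      exact hsub D hD hy
    · intro hy
      exact ⟨_, Finset.mem_image_of_mem _ hy,
        Finset.mem_filter.2 ⟨hy, Relation.EqvGen.refl _⟩⟩
  rw [Finset.union_comm H Ystar, sum_eq_ZZ hacyc hploc hpnorm H Ystar hYH x,
    Finset.prod_congr rfl fun D hD =>
      sum_eq_ZZ hacyc hploc hpnorm H D (hYH.mono_left (hsub D hD)) x]
  conv_lhs => rw [← hU]
  apply ZZ_biUnion hploc
  · exact fun D hD => hYH.mono_left (hsub D hD)
  · intro D hD D' hD' hne
    rw [Finset.disjoint_left]
    exact fun a ha hb => hne (districts_eq hD hD' ha hb (Relation.EqvGen.refl _))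
  · intro D hD D' hD' hne
    rw [Finset.disjoint_left]
    intro h hh hh'
    obtain ⟨_, d, hd, hp⟩ := Finset.mem_filter.1 hh
    obtain ⟨_, d', hd', hp'⟩ := Finset.mem_filter.1 hh'
    exact hne (districts_eq hD hD' hd hd' (Relation.EqvGen.rel _ _ ⟨h, hp, hp'⟩))
end

section
/- (Corollary B) Let G be a directed acyclic graph on disjoint finite vertex sets V and H, let Y* ⊆ V, and let D be a district of Y*. Then pa(D ∪ H_D) ∩ H* = H_D, where H* is the union of H_{D′} over all districts D′ of Y* and pa(S) := ⋃_{s∈S} pa(s). -/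
open Finset
open scoped Classical

/-- Corollary B: `pa(D ∪ H_D) ∩ H* = H_D` for any district `D` of `Ystar`. -/
theorem parents_inter_Hstar_eq_hiddenInto
    {ι : Type*} [Fintype ι] [DecidableEq ι]
    (E : ι → ι → Prop) (V H : Finset ι)
    (hdisj : Disjoint V H) (hcover : V ∪ H = Finset.univ)
    (hacyc : ∀ v, ¬ Relation.TransGen E v v)
    (Ystar : Finset ι) (hY : Ystar ⊆ V)
    (D : Finset ι) (hD : D ∈ districts E H Ystar) :
    parentsOf E (D ∪ hiddenInto E H D) ∩ HstarSet E H Ystar = hiddenInto E H D := by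
  ext u
  simp only [parentsOf, HstarSet, hiddenInto, Finset.mem_inter, Finset.mem_filter,
    Finset.mem_univ, true_and, Finset.mem_union, Finset.mem_biUnion]
  constructor
  · rintro ⟨⟨s, hs, hus⟩, D', _, huH, _⟩
    refine ⟨huH, ?_⟩
    rcases hs with hs | ⟨_, d, hd, hp⟩
    · exact ⟨s, hs, Relation.TransGen.single ⟨hus, huH⟩⟩
    · exact ⟨d, hd, Relation.TransGen.head ⟨hus, huH⟩ hp⟩
  · rintro ⟨huH, d, hd, hp⟩
    refine ⟨?_, D, hD, huH, d, hd, hp⟩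
    rcases Relation.TransGen.head'_iff.1 hp with ⟨s, ⟨hus, _⟩, hsd⟩
    rcases Relation.ReflTransGen.cases_head hsd with rfl | ⟨c, hsc, hcd⟩
    · exact ⟨s, Or.inl hd, hus⟩
    · exact ⟨s, Or.inr ⟨hsc.2, d, hd, Relation.TransGen.head' hsc hcd⟩, hus⟩
end

section
/- (Lemma: marginal SWIG causal model, deterministic form) Let f be a structural system over (ι, E, X), let A ⊆ ι with an assignment a of values a_i ∈ X i for i ∈ A, and let S := ι \ A. Define the marginal system g over (S, E restricted to S, X restricted to S) by g_i(y) := f_i(x), where x is the extension of y : Π_{j∈S} X j setting x_j = a_j for j ∈ A (this is well-defined since f_i depends only on the coordinates in pa(i)). Then for every T ⊆ S and every assignment t of values to T, the unique solution of the intervened marginal system g[T:=t] equals the restriction to S of the unique solution of the intervened full system f[(A ∪ T) := (a, t)]. -/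
open scoped Classical

/-- Marginal SWIG causal model (deterministic form): for a structural system `f`, a set
`A` of indices intervened to values `a`, and the marginal system `g` on `S = ι \ A`
defined by `g i y = f i x` where `x` extends `y` by `a` on `A`, any solution of the
further-intervened marginal system `g[T := t]` equals the restriction to `S` of any
solution of the fully intervened system `f[(A ∪ T) := (a, t)]`. -/
theorem marginal_swig_solution_eq
    {ι : Type*} [Fintype ι]
    (E : ι → ι → Prop)
    (hacyc : ∀ i, ¬ Relation.TransGen E i i)
    (X : ι → Type*) [∀ i, Nonempty (X i)]
    (f : ∀ i, (∀ j, X j) → X i)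
    (hf : ∀ i (x x' : ∀ j, X j), (∀ j, E j i → x j = x' j) → f i x = f i x')
    (A : Set ι) (a : ∀ i, X i)
    (T : Set ι) (hTA : ∀ i ∈ T, i ∉ A) (t : ∀ i, X i)
    -- `y` is the solution of the intervened marginal system `g[T := t]`
    (y : ∀ j : {j : ι // j ∉ A}, X j)
    (hy : ∀ i : {j : ι // j ∉ A},
      y i = if (i : ι) ∈ T then t (i : ι)
            else f (i : ι) (fun j => if h : j ∈ A then a j else y ⟨j, h⟩))
    -- `x` is the solution of the intervened full system `f[(A ∪ T) := (a, t)]`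
    (x : ∀ i, X i)
    (hx : ∀ i, x i = if i ∈ A then a i else if i ∈ T then t i else f i x) :
    ∀ j : {j : ι // j ∉ A}, y j = x (j : ι) := by
  haveI : Std.Irrefl (Relation.TransGen E) := ⟨hacyc⟩
  have wf : WellFounded (Relation.TransGen E) :=
    Finite.wellFounded_of_trans_of_irrefl _
  have key : ∀ i (hi : i ∉ A), y ⟨i, hi⟩ = x i := by
    intro i
    induction i using wf.induction with
    | _ i ih =>
      intro hi
      rw [hy ⟨i, hi⟩, hx i, if_neg hi]
      by_cases hT : i ∈ T
      · simp only [if_pos hT]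
      · simp only [if_neg hT]
        apply hf
        intro j hj
        by_cases hA : j ∈ A
        · rw [dif_pos hA, hx j, if_pos hA]
        · rw [dif_neg hA]
          exact ih j (Relation.TransGen.single hj) hA
  intro j
  exact key j.1 j.2
end

section
/- (Lemma: ancestral sub-causal model, deterministic form) Let f be a structural system over (ι, E, X) and let A ⊆ ι be ancestral, i.e. j ∈ A and E k j imply k ∈ A. Define the subsystem f|_A over (A, E restricted to A, X restricted to A) by (f|_A)_i(y) := f_i(x) for any extension x of y : Π_{j∈A} X j to all of ι (this is well-defined since pa(i) ⊆ A for i ∈ A). Then for every T ⊆ A and every assignment t of values to T, the unique solution of the intervened subsystem (f|_A)[T:=t] equals the restriction to A of the unique solution of the intervened full system f[T:=t]. -/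
open scoped Classical

/-- Ancestral sub-causal model (deterministic form): for a structural system `f` and an
ancestral set `A`, the subsystem `f|_A` defined by `(f|_A) i y = f i x` for any extension
`x` of `y` (here the extension by an arbitrary default assignment `x₀`), any solution of
the intervened subsystem `(f|_A)[T := t]` equals the restriction to `A` of any solution
of the intervened full system `f[T := t]`. -/
theorem ancestral_subsystem_solution_eq
    {ι : Type*} [Fintype ι]
    (E : ι → ι → Prop)
    (hacyc : ∀ i, ¬ Relation.TransGen E i i)
    (X : ι → Type*) [∀ i, Nonempty (X i)]
    (f : ∀ i, (∀ j, X j) → X i)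
    (hf : ∀ i (x x' : ∀ j, X j), (∀ j, E j i → x j = x' j) → f i x = f i x')
    (A : Set ι) (hanc : ∀ j ∈ A, ∀ k, E k j → k ∈ A)
    (T : Set ι) (hTA : T ⊆ A) (t : ∀ i, X i)
    (x₀ : ∀ i, X i)
    -- `y` is the solution of the intervened subsystem `(f|_A)[T := t]`
    (y : ∀ j : {j : ι // j ∈ A}, X j)
    (hy : ∀ i : {j : ι // j ∈ A},
      y i = if (i : ι) ∈ T then t (i : ι)
            else f (i : ι) (fun j => if h : j ∈ A then y ⟨j, h⟩ else x₀ j))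
    -- `x` is the solution of the intervened full system `f[T := t]`
    (x : ∀ i, X i)
    (hx : ∀ i, x i = if i ∈ T then t i else f i x) :
    ∀ j : {j : ι // j ∈ A}, y j = x (j : ι) := by
  have wf : WellFounded (Relation.TransGen E) := by
    haveI : Std.Irrefl (Relation.TransGen E) := ⟨hacyc⟩
    exact Finite.wellFounded_of_trans_of_irrefl _
  have key : ∀ i, ∀ h : i ∈ A, y ⟨i, h⟩ = x i := by
    intro i
    induction i using wf.induction with
    | _ i ih =>
      intro h
      rw [hy ⟨i, h⟩, hx i]
      by_cases hT : i ∈ T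
      · simp only [hT, if_true]
      · simp only [hT, if_false]
        apply hf
        intro j hj
        have hjA := hanc i h j hj
        simp only [hjA, dif_pos]
        exact ih j (Relation.TransGen.single hj) hjA
  exact fun j => key j.1 j.2
end

section
/- (Lemma: conditioning and fixing commute) Let I be a finite index set with finite nonempty state spaces X_i and let q be a nonnegative real-valued function of joint assignments x = (x_i)_{i∈I}. Let C ⊆ I, let c be a fixed assignment of values to C, let A ∈ I \ C, and let N ⊆ I \ {A} with C ⊆ N. Assume m_{I\C}(x) > 0, m_{I\(N∪{A})}(x) > 0, and the sum of φ_A(q) over all reassignments of I\(C∪{A}) is positive, for all joint assignments x with x_C = c, where φ_A(q)(x) := q(x)·m_{I\N}(x)/m_{I\(N∪{A})}(x). Then conditioning on C = c and then fixing A given N yields the same kernel as fixing A given N and then conditioning on C = c: for every joint assignment x with x_C = c, q(x)·m_{I\N}(x) / (m_{I\C}(x)·m_{I\(N∪{A})}(x)) = φ_A(q)(x) / (∑ over reassignments of I\(C∪{A}) of φ_A(q))(x). (The left-hand side is the result of fixing A given N\C in the conditioned kernel q_c := q/m_{I\C}; on the right-hand side, conditioning after fixing sums over reassignments of I\(C∪{A})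 because A has become a context variable.) -/
open Finset
open scoped Classical

section Setup

variable {ι : Type*} [Fintype ι] [DecidableEq ι]

/-- `m_S(x)`: the sum of `q` over all joint assignments agreeing with `x` outside `S`. -/
noncomputable def marg (X : ι → Type*) [∀ i, Fintype (X i)]
    (q : (∀ i, X i) → ℝ) (S : Finset ι) (x : ∀ i, X i) : ℝ :=
  ∑ y ∈ reassign X S x, q y

end Setup

theorem mem_reassign_compl {ι : Type*} [Fintype ι] [DecidableEq ι]
    (X : ι → Type*) [∀ i, Fintype (X i)] (S : Finset ι) (x y : ∀ i, X i) :
    y ∈ reassign X (Finset.univ \ S) x ↔ ∀ i ∈ S, y i = x i := by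
  simp [reassign]

theorem marg_congr_compl {ι : Type*} [Fintype ι] [DecidableEq ι]
    (X : ι → Type*) [∀ i, Fintype (X i)] (q : (∀ i, X i) → ℝ) (S : Finset ι) (x y : ∀ i, X i)
    (h : ∀ i ∈ S, y i = x i) :
    marg X q (Finset.univ \ S) y = marg X q (Finset.univ \ S) x := by
  unfold marg
  congr 1
  ext z
  rw [mem_reassign_compl, mem_reassign_compl]
  exact forall₂_congr fun i hi => by rw [h i hi]

/-- Conditioning on `C = c` and then fixing `A` given `N` yields the same kernel as
fixing `A` given `N` and then conditioning on `C = c`. -/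
theorem conditioning_fixing_commute
    {ι : Type*} [Fintype ι] [DecidableEq ι]
    (X : ι → Type*) [∀ i, Fintype (X i)] [∀ i, Nonempty (X i)]
    (q : (∀ i, X i) → ℝ) (hq : ∀ x, 0 ≤ q x)
    (C : Finset ι) (c : ∀ i, X i)
    (A : ι) (hAC : A ∉ C)
    (N : Finset ι) (hAN : A ∉ N) (hCN : C ⊆ N)
    (hposC : ∀ x : ∀ i, X i, (∀ i ∈ C, x i = c i) →
      0 < marg X q (Finset.univ \ C) x)
    (hposNA : ∀ x : ∀ i, X i, (∀ i ∈ C, x i = c i) →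
      0 < marg X q (Finset.univ \ insert A N) x)
    (hposFix : ∀ x : ∀ i, X i, (∀ i ∈ C, x i = c i) →
      0 < ∑ y ∈ reassign X (Finset.univ \ insert A C) x,
            q y * marg X q (Finset.univ \ N) y / marg X q (Finset.univ \ insert A N) y) :
    ∀ x : ∀ i, X i, (∀ i ∈ C, x i = c i) →
      q x * marg X q (Finset.univ \ N) x
          / (marg X q (Finset.univ \ C) x * marg X q (Finset.univ \ insert A N) x)
        = (q x * marg X q (Finset.univ \ N) x / marg X q (Finset.univ \ insert A N) x)
            / ∑ y ∈ reassign X (Finset.univ \ insert A C) x,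
                q y * marg X q (Finset.univ \ N) y
                  / marg X q (Finset.univ \ insert A N) y := by
  intro x hx
  have key : ∑ y ∈ reassign X (Finset.univ \ insert A C) x,
      q y * marg X q (Finset.univ \ N) y / marg X q (Finset.univ \ insert A N) y
      = marg X q (Finset.univ \ C) x := by
    have h1 : ∀ y, q y * marg X q (Finset.univ \ N) y / marg X q (Finset.univ \ insert A N) y
        = ∑ z ∈ reassign X (Finset.univ \ N) y,
          q z * (q y / marg X q (Finset.univ \ insert A N) y) := by
      intro y
      rw [← Finset.sum_mul]
      change _ = marg X q (Finset.univ \ N) y * _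
      ring
    simp only [h1]
    rw [Finset.sum_comm' (s' := fun z =>
        reassign X (Finset.univ \ insert A N) (Function.update z A (x A)))
      (t' := reassign X (Finset.univ \ C) x)]
    · unfold marg
      refine Finset.sum_congr rfl fun z hz => ?_
      rw [mem_reassign_compl] at hz
      rw [← Finset.mul_sum]
      have hw := hposNA (Function.update z A (x A)) (fun i hi => by
        have : i ≠ A := fun h => hAC (h ▸ hi)
        rw [Function.update_of_ne this, hz i hi, hx i hi])
      have : ∑ y ∈ reassign X (Finset.univ \ insert A N) (Function.update z A (x A)),
          q y / marg X q (Finset.univ \ insert A N) y = 1 := by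
        rw [← div_self hw.ne']
        conv_rhs => rw [marg, Finset.sum_div]
        refine Finset.sum_congr rfl fun y hy => ?_
        rw [mem_reassign_compl] at hy
        rw [marg_congr_compl X q _ _ _ hy, marg]
      unfold marg at this
      rw [this, mul_one]
    · intro y z
      simp only [mem_reassign_compl, Finset.forall_mem_insert, Function.update_self]
      have hne : ∀ i ∈ N, i ≠ A := fun i hi h => hAN (h ▸ hi)
      constructor
      · rintro ⟨⟨ha, hc⟩, hz⟩
        refine ⟨⟨ha, fun i hi => ?_⟩, fun i hi => ?_⟩
        · rw [Function.update_of_ne (hne i hi), hz i hi]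
        · rw [hz i (hCN hi), hc i hi]
      · rintro ⟨⟨ha, hn⟩, hc⟩
        have hz : ∀ i ∈ N, z i = y i := fun i hi => by
          rw [hn i hi, Function.update_of_ne (hne i hi)]
        exact ⟨⟨ha, fun i hi => by rw [← hz i (hCN hi), hc i hi]⟩, hz⟩
  rw [key, div_div, mul_comm (marg X q (Finset.univ \ C) x)]
end

section
/- (Fixing preserves total mass) Let I be a finite index set with finite nonempty state spaces X_i and let q be a nonnegative real-valued function of joint assignments. Let C ⊆ I, A ∈ I \ C, and N ⊆ I \ {A} with C ⊆ N, and assume m_{I\(N∪{A})}(x) > 0 for all joint assignments x. Define φ_A(q)(x) := q(x)·m_{I\N}(x)/m_{I\(N∪{A})}(x). Then for every joint assignment x, the sum of φ_A(q) over all reassignments of I\(C∪{A}) equals m_{I\C}(x), the sum of q over all reassignments of I\C. -/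
open Finset
open scoped Classical

/-- Fixing preserves total mass: the sum of `φ_A(q)` over reassignments of `I \ (C ∪ {A})`
equals the sum of `q` over reassignments of `I \ C`. -/
theorem fixing_preserves_mass
    {ι : Type*} [Fintype ι] [DecidableEq ι]
    (X : ι → Type*) [∀ i, Fintype (X i)] [∀ i, Nonempty (X i)]
    (q : (∀ i, X i) → ℝ) (hq : ∀ x, 0 ≤ q x)
    (C : Finset ι) (A : ι) (hAC : A ∉ C)
    (N : Finset ι) (hAN : A ∉ N) (hCN : C ⊆ N)
    (hpos : ∀ x : ∀ i, X i, 0 < marg X q (Finset.univ \ insert A N) x) :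
    ∀ x : ∀ i, X i,
      ∑ y ∈ reassign X (Finset.univ \ insert A C) x,
          q y * marg X q (Finset.univ \ N) y / marg X q (Finset.univ \ insert A N) y
        = marg X q (Finset.univ \ C) x := by
  intro x
  have key : ∀ y : ∀ i, X i,
      q y * marg X q (Finset.univ \ N) y / marg X q (Finset.univ \ insert A N) y
      = ∑ z ∈ reassign X (Finset.univ \ N) y,
          q z * (q y / marg X q (Finset.univ \ insert A N) y) := by
    intro y
    rw [← Finset.sum_mul]
    change _ = marg X q (Finset.univ \ N) y * _
    ring
  rw [Finset.sum_congr rfl (fun y _ => key y)]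
  rw [Finset.sum_comm' (s' := fun z => reassign X (Finset.univ \ insert A N)
      (Function.update z A (x A))) (t' := reassign X (Finset.univ \ C) x)]
  · unfold marg
    refine Finset.sum_congr rfl fun z _ => ?_
    change _ = q z
    rw [← Finset.mul_sum]
    have h2 : ∀ y ∈ reassign X (Finset.univ \ insert A N) (Function.update z A (x A)),
        reassign X (Finset.univ \ insert A N) y
        = reassign X (Finset.univ \ insert A N) (Function.update z A (x A)) := by
      intro y hy
      simp only [reassign, Finset.mem_filter, Finset.mem_univ, true_and] at hy
      ext w
      simp only [reassign, Finset.mem_filter, Finset.mem_univ, true_and]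
      exact forall₂_congr fun i hi => by rw [hy i hi]
    rw [Finset.sum_congr rfl (fun y hy => by rw [h2 y hy]), ← Finset.sum_div,
      div_self, mul_one]
    exact (hpos (Function.update z A (x A))).ne'
  · intro y z
    simp only [reassign, Finset.mem_filter, Finset.mem_univ, true_and, Finset.mem_sdiff,
      not_not, Finset.mem_insert]
    constructor
    · rintro ⟨h1, h2⟩
      refine ⟨?_, fun i hi => (h2 i (hCN hi)).trans (h1 i (Or.inr hi))⟩
      rintro i (rfl | hi)
      · rw [Function.update_self]; exact h1 _ (Or.inl rfl)
      · rw [Function.update_of_ne (fun h : i = A => hAN (h ▸ hi))]; exact (h2 i hi).symm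
    · rintro ⟨h1, h2⟩
      have h3 : ∀ i ∈ N, z i = y i := fun i hi => by
        rw [h1 i (Or.inr hi), Function.update_of_ne (fun h : i = A => hAN (h ▸ hi))]
      refine ⟨?_, h3⟩
      rintro i (rfl | hi)
      · rw [h1 _ (Or.inl rfl), Function.update_self]
      · rw [← h3 i (hCN hi), h2 i hi]
end

section
/- (Unique solvability of acyclic structural systems) Let ι be a finite type, E : ι → ι → Prop an edge relation whose transitive closure is irreflexive (no directed cycles), X a family of nonempty types, and f = (f_i)_{i∈ι} a family of functions f_i : (Π j, X j) → X i such that f_i x = f_i x′ whenever x and x′ agree on pa(i) := {j : E j i}. Then there exists a unique x : Π i, X i with x i = f_i x for every i ∈ ι. -/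
/-- Unique solvability of acyclic structural systems. -/
theorem acyclic_structural_system_unique_solution
    {ι : Type*} [Fintype ι]
    (E : ι → ι → Prop)
    (hacyc : ∀ i, ¬ Relation.TransGen E i i)
    (X : ι → Type*) [∀ i, Nonempty (X i)]
    (f : ∀ i, (∀ j, X j) → X i)
    (hf : ∀ i (x x' : ∀ j, X j), (∀ j, E j i → x j = x' j) → f i x = f i x') :
    ∃! x : ∀ i, X i, ∀ i, x i = f i x := by
  classical
  have wfT : WellFounded (Relation.TransGen E) := by
    haveI : Std.Irrefl (Relation.TransGen E) := ⟨hacyc⟩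
    haveI : IsTrans ι (Relation.TransGen E) := ⟨fun _ _ _ => Relation.TransGen.trans⟩
    exact Finite.wellFounded_of_trans_of_irrefl _
  have wf : WellFounded E :=
    Subrelation.wf (fun {_ _} h => Relation.TransGen.single h) wfT
  let F : ∀ i, (∀ j, E j i → X j) → X i := fun i g =>
    f i (fun j => if h : E j i then g j h else Classical.arbitrary (X j))
  refine ⟨fun i => wf.fix F i, ?_, ?_⟩
  · intro i
    show wf.fix F i = _
    rw [WellFounded.fix_eq]
    apply hf
    intro j hj
    simp [hj]
  · intro y hy
    funext i
    induction i using wf.induction with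
    | _ i ih =>
      rw [hy i, WellFounded.fix_eq]
      apply hf
      intro j hj
      simp only [hj, dif_pos]
      exact ih j hj
end

section
/- (Reduction to relevant hidden variables) Let G be a directed acyclic graph on disjoint finite vertex sets V and H, let Y* ⊆ V, and let Markov kernels p_v be given for all vertices. Then for every joint assignment x, the sum over all reassignments of H of the product, over v ∈ H ∪ Y*, of p_v equals the sum over all reassignments of H* of the product, over v ∈ H* ∪ Y*, of p_v. -/
open Finset
open scoped Classical

theorem sum_reassign_insert_aux {ι : Type*} [Fintype ι] [DecidableEq ι]
    (X : ι → Type*) [∀ i, Fintype (X i)] (S : Finset ι) (h : ι) (hS : h ∉ S)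
    (x : ∀ i, X i) (f : (∀ i, X i) → ℝ) :
    ∑ y ∈ reassign X (insert h S) x, f y
      = ∑ y ∈ reassign X S x, ∑ s : X h, f (Function.update y h s) := by
  rw [← Finset.sum_product']
  symm
  refine Finset.sum_bij' (fun q _ => Function.update q.1 h q.2)
    (fun y _ => (Function.update y h (x h), y h)) ?_ ?_ ?_ ?_ ?_
  · rintro ⟨y, s⟩ hy
    simp only [reassign, Finset.mem_product, Finset.mem_filter, Finset.mem_univ, true_and,
      and_true, Finset.mem_insert, not_or] at hy ⊢
    rintro i ⟨hi, hiS⟩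
    rw [Function.update_of_ne hi]
    exact hy i hiS
  · intro y hy
    simp only [reassign, Finset.mem_product, Finset.mem_filter, Finset.mem_univ, true_and,
      and_true, Finset.mem_insert, not_or] at hy ⊢
    intro i hiS
    by_cases hi : i = h
    · subst hi; simp
    · rw [Function.update_of_ne hi]
      exact hy i ⟨hi, hiS⟩
  · rintro ⟨y, s⟩ hy
    simp only [reassign, Finset.mem_product, Finset.mem_filter, Finset.mem_univ, true_and,
      and_true] at hy
    have := hy h hS
    simp [← this]
  · intro y hy
    simp
  · intro q hq
    rfl

theorem mem_Hstar_aux {ι : Type*} [Fintype ι] [DecidableEq ι]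
    (E : ι → ι → Prop) (H Ystar : Finset ι) (h : ι) :
    h ∈ HstarSet E H Ystar ↔ h ∈ H ∧ ∃ d ∈ Ystar, HPath E H h d := by
  simp only [HstarSet, districts, hiddenInto, Finset.mem_biUnion, Finset.mem_image,
    Finset.mem_filter]
  constructor
  · rintro ⟨D, ⟨y, hy, rfl⟩, hH, d, hd, hp⟩
    exact ⟨hH, d, (Finset.mem_filter.1 hd).1, hp⟩
  · rintro ⟨hH, d, hd, hp⟩
    exact ⟨_, ⟨d, hd, rfl⟩, hH, d, Finset.mem_filter.2 ⟨hd, Relation.EqvGen.refl d⟩, hp⟩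

/-- Reduction to relevant hidden variables: marginalizing all hidden variables equals
marginalizing only those in `H*`. -/
theorem sum_hidden_eq_sum_Hstar
    {ι : Type*} [Fintype ι] [DecidableEq ι]
    (E : ι → ι → Prop) (V H : Finset ι)
    (hdisj : Disjoint V H) (hcover : V ∪ H = Finset.univ)
    (hacyc : ∀ v, ¬ Relation.TransGen E v v)
    (Ystar : Finset ι) (hY : Ystar ⊆ V)
    (X : ι → Type*) [∀ i, Fintype (X i)] [∀ i, Nonempty (X i)]
    (p : ι → (∀ i, X i) → ℝ)
    (hp0 : ∀ v x, 0 ≤ p v x)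
    (hploc : ∀ v (x y : ∀ i, X i), x v = y v → (∀ u, E u v → x u = y u) → p v x = p v y)
    (hpnorm : ∀ v (x : ∀ i, X i), ∑ s : X v, p v (Function.update x v s) = 1) :
    ∀ x : ∀ i, X i,
      ∑ y ∈ reassign X H x, ∏ v ∈ H ∪ Ystar, p v y
        = ∑ y ∈ reassign X (HstarSet E H Ystar) x,
            ∏ v ∈ HstarSet E H Ystar ∪ Ystar, p v y := by
  intro x
  have hYH : ∀ v ∈ Ystar, v ∉ H := fun v hv hvH => Finset.disjoint_left.1 hdisj (hY hv) hvH
  have key : ∀ n : ℕ, ∀ T : Finset ι, T.card = n → T ⊆ H →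
      Disjoint T (HstarSet E H Ystar) →
      ∑ y ∈ reassign X (T ∪ HstarSet E H Ystar) x,
          ∏ v ∈ T ∪ (HstarSet E H Ystar ∪ Ystar), p v y
        = ∑ y ∈ reassign X (HstarSet E H Ystar) x,
            ∏ v ∈ HstarSet E H Ystar ∪ Ystar, p v y := by
    intro n
    induction n with
    | zero =>
      intro T hT _ _
      rw [Finset.card_eq_zero] at hT
      subst hT
      simp
    | succ n ih =>
      intro T hT hTH hTd
      have hne : T.Nonempty := by
        rw [← Finset.card_pos]; omega
      let R : ι → ι → Prop := fun a b => Relation.TransGen E b a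
      have : IsTrans ι R := ⟨fun a b c h1 h2 => Relation.TransGen.trans h2 h1⟩
      have : Std.Irrefl R := ⟨fun a h => hacyc a h⟩
      have wf : WellFounded R := Finite.wellFounded_of_trans_of_irrefl R
      obtain ⟨h, hhT, hmin⟩ := wf.has_min (T : Set ι) hne
      have hhT : h ∈ T := hhT
      have hhS : h ∉ HstarSet E H Ystar := Finset.disjoint_left.1 hTd hhT
      have hhH := hTH hhT
      have hnoE : ∀ v ∈ T ∪ (HstarSet E H Ystar ∪ Ystar), ¬ E h v := by
        intro v hv hE
        simp only [Finset.mem_union] at hv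
        rcases hv with hv | hv | hv
        · exact hmin v hv (Relation.TransGen.single hE)
        · obtain ⟨_, d, hd, hp⟩ := (mem_Hstar_aux E H Ystar v).1 hv
          exact hhS ((mem_Hstar_aux E H Ystar h).2
            ⟨hhH, d, hd, Relation.TransGen.head ⟨hE, hhH⟩ hp⟩)
        · exact hhS ((mem_Hstar_aux E H Ystar h).2
            ⟨hhH, v, hv, Relation.TransGen.single ⟨hE, hhH⟩⟩)
      have hT' : insert h (T.erase h) = T := Finset.insert_erase hhT
      have hih := ih (T.erase h) (by rw [Finset.card_erase_of_mem hhT]; omega)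
        ((Finset.erase_subset _ _).trans hTH)
        (Finset.disjoint_of_subset_left (Finset.erase_subset _ _) hTd)
      rw [← hih]
      have e1 : T ∪ HstarSet E H Ystar = insert h (T.erase h ∪ HstarSet E H Ystar) := by
        rw [← Finset.insert_union, hT']
      have e2 : T ∪ (HstarSet E H Ystar ∪ Ystar)
          = insert h (T.erase h ∪ (HstarSet E H Ystar ∪ Ystar)) := by
        rw [← Finset.insert_union, hT']
      have hn1 : h ∉ T.erase h ∪ HstarSet E H Ystar := by
        simp [hhS]
      have hn2 : h ∉ T.erase h ∪ (HstarSet E H Ystar ∪ Ystar) := by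
        have : h ∉ Ystar := fun hy => hYH h hy hhH
        simp [hhS, this]
      rw [e2] at hnoE
      rw [e1, e2, sum_reassign_insert_aux X _ h hn1]
      refine Finset.sum_congr rfl fun y _ => ?_
      have : ∀ s : X h, ∏ v ∈ insert h (T.erase h ∪ (HstarSet E H Ystar ∪ Ystar)),
          p v (Function.update y h s) = p h (Function.update y h s) *
            ∏ v ∈ T.erase h ∪ (HstarSet E H Ystar ∪ Ystar), p v y := by
        intro s
        rw [Finset.prod_insert hn2]
        congr 1
        refine Finset.prod_congr rfl fun v hv => ?_
        apply hploc
        · exact Function.update_of_ne (fun e : v = h => hn2 (e ▸ hv)) _ _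
        · intro u hu
          refine Function.update_of_ne (fun e => ?_) _ _
          subst e
          exact hnoE v (Finset.mem_insert_of_mem hv) hu
      rw [Finset.sum_congr rfl fun s _ => this s, ← Finset.sum_mul, hpnorm, one_mul]
  have hsub : HstarSet E H Ystar ⊆ H := fun h hh => ((mem_Hstar_aux E H Ystar h).1 hh).1
  have := key _ (H \ HstarSet E H Ystar) rfl Finset.sdiff_subset Finset.sdiff_disjoint
  rw [← Finset.union_assoc, Finset.sdiff_union_of_subset hsub] at this
  exact this
end

section
/- (District block factorization) Let G be a directed acyclic graph on disjoint finite vertex sets V and H, let Y* ⊆ V, and let Markov kernels p_v be given for all vertices. Then for every joint assignment x, the sum over all reassignments of H* of the product, over v ∈ H* ∪ Y*, of p_v equals the product, over all districts D of Y*, of the sum over all reassignments of H_D of the product, over v ∈ D ∪ H_D, of p_v. -/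
open Finset
open scoped Classical

theorem sum_reassign_union_s12 {ι : Type*} [Fintype ι] [DecidableEq ι]
    (X : ι → Type*) [∀ i, Fintype (X i)] (A B : Finset ι) (hAB : Disjoint A B)
    (f g : (∀ i, X i) → ℝ)
    (hf : ∀ y z : ∀ i, X i, (∀ i ∉ B, y i = z i) → f y = f z)
    (hg : ∀ y z : ∀ i, X i, (∀ i ∉ A, y i = z i) → g y = g z) (x : ∀ i, X i) :
    ∑ y ∈ reassign X (A ∪ B) x, f y * g y
      = (∑ y ∈ reassign X A x, f y) * ∑ y ∈ reassign X B x, g y := by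
  have hd : ∀ i, i ∈ A → i ∉ B := fun i hi => Finset.disjoint_left.mp hAB hi
  rw [Finset.sum_mul_sum, ← Finset.sum_product']
  symm
  refine Finset.sum_bij' (fun q _ => A.piecewise q.1 q.2)
    (fun w _ => (A.piecewise w x, B.piecewise w x)) ?_ ?_ ?_ ?_ ?_
  · rintro ⟨y, z⟩ h
    simp only [reassign, Finset.mem_product, Finset.mem_filter, Finset.mem_univ, true_and,
      Finset.mem_union, not_or] at h ⊢
    intro i hi
    simp [hi.1, h.2 i hi.2]
  · intro w h
    simp only [reassign, Finset.mem_product, Finset.mem_filter, Finset.mem_univ, true_and,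
      Finset.mem_union, not_or] at h ⊢
    constructor <;> intro i hi <;> simp [hi]
  · rintro ⟨y, z⟩ h
    simp only [reassign, Finset.mem_product, Finset.mem_filter, Finset.mem_univ, true_and] at h ⊢
    ext i
    · by_cases hi : i ∈ A
      · simp [hi]
      · simp [hi, h.1 i hi]
    · by_cases hi : i ∈ B
      · have : i ∉ A := fun h' => hd i h' hi
        simp [hi, this]
      · simp [hi, h.2 i hi]
  · intro w h
    simp only [reassign, Finset.mem_filter, Finset.mem_univ, true_and,
      Finset.mem_union, not_or] at h ⊢
    ext i
    by_cases hi : i ∈ A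
    · simp [hi]
    · by_cases hi' : i ∈ B
      · simp [hi, hi']
      · simp [hi, hi', h i ⟨hi, hi'⟩]
  · rintro ⟨y, z⟩ h
    simp only [reassign, Finset.mem_product, Finset.mem_filter, Finset.mem_univ, true_and] at h ⊢
    congr 1
    · apply hf
      intro i hi
      by_cases hA : i ∈ A
      · simp [hA]
      · simp [hA, h.1 i hA, h.2 i hi]
    · apply hg
      intro i hi
      simp [hi]

theorem sum_reassign_biUnion {ι κ : Type*} [Fintype ι] [DecidableEq ι] [DecidableEq κ]
    (X : ι → Type*) [∀ i, Fintype (X i)] (H : Finset ι) (S : κ → Finset ι)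
    (f : κ → (∀ i, X i) → ℝ) (x : ∀ i, X i) (K : Finset κ)
    (hS : ∀ D ∈ K, S D ⊆ H)
    (hd : ∀ D ∈ K, ∀ D' ∈ K, D ≠ D' → Disjoint (S D) (S D'))
    (hf : ∀ D ∈ K, ∀ y z : ∀ i, X i, (∀ i, i ∉ H ∨ i ∈ S D → y i = z i) → f D y = f D z) :
    ∑ y ∈ reassign X (K.biUnion S) x, ∏ D ∈ K, f D y
      = ∏ D ∈ K, ∑ y ∈ reassign X (S D) x, f D y := by
  induction K using Finset.induction_on with
  | empty =>
    have : reassign X ∅ x = {x} := by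
      ext y; simp [reassign, funext_iff]
    simp [this]
  | insert a K ha ih =>
    have hda : ∀ D ∈ K, Disjoint (S a) (S D) := fun D hD =>
      hd a (Finset.mem_insert_self _ _) D (Finset.mem_insert_of_mem hD)
        (fun h => ha (h ▸ hD))
    rw [Finset.prod_insert ha, ← ih (fun D hD => hS D (Finset.mem_insert_of_mem hD))
      (fun D hD D' hD' => hd D (Finset.mem_insert_of_mem hD) D' (Finset.mem_insert_of_mem hD'))
      (fun D hD => hf D (Finset.mem_insert_of_mem hD)), Finset.biUnion_insert]
    simp only [Finset.prod_insert ha]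
    apply sum_reassign_union_s12
    · rw [Finset.disjoint_biUnion_right]; exact hda
    · intro y z h
      apply hf a (Finset.mem_insert_self _ _)
      intro i hi
      apply h
      simp only [Finset.mem_biUnion, not_exists, not_and]
      intro D hD hiD
      rcases hi with hi | hi
      · exact hi (hS D (Finset.mem_insert_of_mem hD) hiD)
      · exact Finset.disjoint_left.mp (hda D hD) hi hiD
    · intro y z h
      apply Finset.prod_congr rfl
      intro D hD
      apply hf D (Finset.mem_insert_of_mem hD)
      intro i hi
      apply h
      intro hia
      rcases hi with hi | hi
      · exact hi (hS a (Finset.mem_insert_self _ _) hia)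
      · exact Finset.disjoint_left.mp (hda D hD) hia hi

/-- District block factorization: the sum over `H*` of the product over `H* ∪ Y*`
factorizes into blocks, one per district. -/
theorem district_block_factorization
    {ι : Type*} [Fintype ι] [DecidableEq ι]
    (E : ι → ι → Prop) (V H : Finset ι)
    (hdisj : Disjoint V H) (hcover : V ∪ H = Finset.univ)
    (hacyc : ∀ v, ¬ Relation.TransGen E v v)
    (Ystar : Finset ι) (hY : Ystar ⊆ V)
    (X : ι → Type*) [∀ i, Fintype (X i)] [∀ i, Nonempty (X i)]
    (p : ι → (∀ i, X i) → ℝ)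
    (hp0 : ∀ v x, 0 ≤ p v x)
    (hploc : ∀ v (x y : ∀ i, X i), x v = y v → (∀ u, E u v → x u = y u) → p v x = p v y)
    (hpnorm : ∀ v (x : ∀ i, X i), ∑ s : X v, p v (Function.update x v s) = 1) :
    ∀ x : ∀ i, X i,
      ∑ y ∈ reassign X (HstarSet E H Ystar) x,
          ∏ v ∈ HstarSet E H Ystar ∪ Ystar, p v y
        = ∏ D ∈ districts E H Ystar,
            ∑ y ∈ reassign X (hiddenInto E H D) x,
              ∏ v ∈ D ∪ hiddenInto E H D, p v y := by
  intro x
  have hdist : ∀ D ∈ districts E H Ystar, ∀ D' ∈ districts E H Ystar,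
      ∀ d ∈ D, ∀ d' ∈ D', Relation.EqvGen (DistrictRel E H) d d' → D = D' := by
    intro D hD D' hD' d hd d' hd' hr
    simp only [districts, Finset.mem_image] at hD hD'
    obtain ⟨y, -, rfl⟩ := hD
    obtain ⟨y', -, rfl⟩ := hD'
    simp only [Finset.mem_filter] at hd hd'
    have h1 : Relation.EqvGen (DistrictRel E H) y y' :=
      (hd.2.trans _ _ _ hr).trans _ _ _ (hd'.2.symm _ _)
    ext w
    simp only [Finset.mem_filter]
    exact and_congr_right fun _ =>
      ⟨fun h => (h1.symm _ _).trans _ _ _ h, fun h => h1.trans _ _ _ h⟩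
  have hsub : ∀ D ∈ districts E H Ystar, D ⊆ Ystar := by
    intro D hD
    simp only [districts, Finset.mem_image] at hD
    obtain ⟨y, -, rfl⟩ := hD
    exact Finset.filter_subset _ _
  have hHsub : ∀ D, hiddenInto E H D ⊆ H := fun D => Finset.filter_subset _ _
  have hHdisj : ∀ D ∈ districts E H Ystar, ∀ D' ∈ districts E H Ystar, D ≠ D' →
      Disjoint (hiddenInto E H D) (hiddenInto E H D') := by
    intro D hD D' hD' hne
    rw [Finset.disjoint_left]
    intro h h1 h2
    simp only [hiddenInto, Finset.mem_filter] at h1 h2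
    obtain ⟨-, d, hd, hp⟩ := h1
    obtain ⟨-, d', hd', hp'⟩ := h2
    exact hne (hdist D hD D' hD' d hd d' hd' (Relation.EqvGen.rel _ _ ⟨h, hp, hp'⟩))
  have hYH : ∀ i ∈ Ystar, i ∉ H := fun i hi => Finset.disjoint_left.mp hdisj (hY hi)
  have hset : HstarSet E H Ystar ∪ Ystar
      = (districts E H Ystar).biUnion fun D => D ∪ hiddenInto E H D := by
    ext i
    simp only [HstarSet, Finset.mem_union, Finset.mem_biUnion]
    constructor
    · rintro (⟨D, hD, h⟩ | h)
      · exact ⟨D, hD, Or.inr h⟩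
      · refine ⟨_, Finset.mem_image_of_mem _ h, Or.inl ?_⟩
        simp only [Finset.mem_filter]
        exact ⟨h, Relation.EqvGen.refl _⟩
    · rintro ⟨D, hD, h | h⟩
      · exact Or.inr (hsub D hD h)
      · exact Or.inl ⟨D, hD, h⟩
  have hpd : Set.PairwiseDisjoint (↑(districts E H Ystar) : Set (Finset ι))
      (fun D => D ∪ hiddenInto E H D) := by
    intro D hD D' hD' hne
    change Disjoint (D ∪ hiddenInto E H D) (D' ∪ hiddenInto E H D')
    rw [Finset.disjoint_left]
    intro i h1 h2
    rw [Finset.mem_union] at h1 h2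
    rcases h1 with h1 | h1 <;> rcases h2 with h2 | h2
    · exact hne (hdist D hD D' hD' i h1 i h2 (Relation.EqvGen.refl _))
    · exact hYH i (hsub D hD h1) (hHsub _ h2)
    · exact hYH i (hsub D' hD' h2) (hHsub _ h1)
    · exact Finset.disjoint_left.mp (hHdisj D hD D' hD' hne) h1 h2
  rw [hset]
  simp only [Finset.prod_biUnion hpd]
  refine sum_reassign_biUnion X H (hiddenInto E H) (fun D y => ∏ v ∈ D ∪ hiddenInto E H D, p v y)
    x (districts E H Ystar) (fun D _ => hHsub D) hHdisj ?_
  intro D hD y z h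
  apply Finset.prod_congr rfl
  intro v hv
  rw [Finset.mem_union] at hv
  apply hploc
  · apply h
    rcases hv with hv | hv
    · exact Or.inl (hYH v (hsub D hD hv))
    · exact Or.inr hv
  · intro u hu
    apply h
    by_cases huH : u ∈ H
    · right
      simp only [hiddenInto, Finset.mem_filter] at hv ⊢
      refine ⟨huH, ?_⟩
      rcases hv with hv | ⟨-, d, hd, hp⟩
      · exact ⟨v, hv, Relation.TransGen.single ⟨hu, huH⟩⟩
      · exact ⟨d, hd, Relation.TransGen.head ⟨hu, huH⟩ hp⟩
    · exact Or.inl huH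
end

section
/- (Extension of a district sum to all hidden variables) Let G be a directed acyclic graph on disjoint finite vertex sets V and H, let D ⊆ V, and let Markov kernels p_v be given for all vertices. Then for every joint assignment x, the sum over all reassignments of H_D of the product, over v ∈ D ∪ H_D, of p_v equals the sum over all reassignments of H of the product, over v ∈ D ∪ H, of p_v. -/
open Finset
open scoped Classical

theorem aux_sum_insert {ι : Type*} [Fintype ι] [DecidableEq ι]
    (X : ι → Type*) [∀ i, Fintype (X i)] (S : Finset ι) (t : ι) (ht : t ∉ S)
    (f : (∀ i, X i) → ℝ) (x : ∀ i, X i) :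
    ∑ y ∈ reassign X (insert t S) x, f y
      = ∑ y ∈ reassign X S x, ∑ s : X t, f (Function.update y t s) := by
  rw [← Finset.sum_product' (reassign X S x) Finset.univ
    (fun y s => f (Function.update y t s))]
  symm
  refine Finset.sum_bij' (fun q _ => Function.update q.1 t q.2)
    (fun z _ => (Function.update z t (x t), z t)) ?_ ?_ ?_ ?_ ?_
  · rintro ⟨y, s⟩ h
    simp only [reassign, Finset.mem_product, Finset.mem_filter, Finset.mem_univ, true_and,
      and_true] at h ⊢
    intro i hi
    rw [Finset.mem_insert, not_or] at hi
    rw [Function.update_of_ne hi.1]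
    exact h i hi.2
  · intro z h
    simp only [reassign, Finset.mem_product, Finset.mem_filter, Finset.mem_univ, true_and,
      and_true] at h ⊢
    intro i hi
    by_cases hit : i = t
    · subst hit; simp
    · rw [Function.update_of_ne hit]
      exact h i (by simp [hit, hi])
  · rintro ⟨y, s⟩ h
    simp only [reassign, Finset.mem_product, Finset.mem_filter, Finset.mem_univ, true_and,
      and_true] at h
    simp [← h t ht]
  · intro z h
    simp
  · intro q h
    rfl

theorem aux_sink {ι : Type*} [Fintype ι] (E : ι → ι → Prop)
    (hacyc : ∀ v, ¬ Relation.TransGen E v v) (T : Finset ι) (hT : T.Nonempty) :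
    ∃ t ∈ T, ∀ v ∈ T, ¬ E t v := by
  haveI : Std.Irrefl (fun a b => Relation.TransGen E b a) := ⟨fun a => hacyc a⟩
  haveI : IsTrans ι (fun a b => Relation.TransGen E b a) := ⟨fun a b c h1 h2 => h2.trans h1⟩
  have wf := Finite.wellFounded_of_trans_of_irrefl (fun a b => Relation.TransGen E b a)
  obtain ⟨t, ht, h⟩ := wf.has_min (T : Set ι) hT
  exact ⟨t, ht, fun v hv e => h v hv (Relation.TransGen.single e)⟩

/-- Extension of a district sum to all hidden variables. -/
theorem district_sum_extend_hidden
    {ι : Type*} [Fintype ι] [DecidableEq ι]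
    (E : ι → ι → Prop) (V H : Finset ι)
    (hdisj : Disjoint V H) (hcover : V ∪ H = Finset.univ)
    (hacyc : ∀ v, ¬ Relation.TransGen E v v)
    (D : Finset ι) (hDV : D ⊆ V)
    (X : ι → Type*) [∀ i, Fintype (X i)] [∀ i, Nonempty (X i)]
    (p : ι → (∀ i, X i) → ℝ)
    (hp0 : ∀ v x, 0 ≤ p v x)
    (hploc : ∀ v (x y : ∀ i, X i), x v = y v → (∀ u, E u v → x u = y u) → p v x = p v y)
    (hpnorm : ∀ v (x : ∀ i, X i), ∑ s : X v, p v (Function.update x v s) = 1) :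
    ∀ x : ∀ i, X i,
      ∑ y ∈ reassign X (hiddenInto E H D) x, ∏ v ∈ D ∪ hiddenInto E H D, p v y
        = ∑ y ∈ reassign X H x, ∏ v ∈ D ∪ H, p v y := by
  intro x
  have hHD : hiddenInto E H D ⊆ H := Finset.filter_subset _ _
  have key : ∀ n : ℕ, ∀ T : Finset ι, T.card = n → T ⊆ H → Disjoint T (hiddenInto E H D) →
      ∑ y ∈ reassign X (hiddenInto E H D) x, ∏ v ∈ D ∪ hiddenInto E H D, p v y
        = ∑ y ∈ reassign X (T ∪ hiddenInto E H D) x,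
            ∏ v ∈ D ∪ (T ∪ hiddenInto E H D), p v y := by
    intro n
    induction n with
    | zero =>
      intro T hT _ _
      rw [Finset.card_eq_zero] at hT
      subst hT
      simp
    | succ n ih =>
      intro T hT hTH hdis
      obtain ⟨t, ht, hsink⟩ := aux_sink E hacyc T (by
        rw [← Finset.card_pos]; omega)
      have htH : t ∈ H := hTH ht
      have htHD : t ∉ hiddenInto E H D := Finset.disjoint_left.mp hdis ht
      have htD : t ∉ D := fun h => Finset.disjoint_left.mp hdisj (hDV h) htH
      have hchD : ∀ v ∈ D, ¬ E t v := fun v hv e => htHD (by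
        rw [hiddenInto, Finset.mem_filter]
        exact ⟨htH, v, hv, Relation.TransGen.single ⟨e, htH⟩⟩)
      have hchHD : ∀ v ∈ hiddenInto E H D, ¬ E t v := fun v hv e => htHD (by
        rw [hiddenInto, Finset.mem_filter] at hv ⊢
        obtain ⟨_, d, hd, hpth⟩ := hv
        exact ⟨htH, d, hd, Relation.TransGen.head ⟨e, htH⟩ hpth⟩)
      rw [ih (T.erase t) (by rw [Finset.card_erase_of_mem ht]; omega)
        ((Finset.erase_subset _ _).trans hTH)
        (Finset.disjoint_of_subset_left (Finset.erase_subset _ _) hdis)]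
      have htS : t ∉ T.erase t ∪ hiddenInto E H D := by simp [htHD]
      have hS : T ∪ hiddenInto E H D = insert t (T.erase t ∪ hiddenInto E H D) := by
        rw [← Finset.insert_union, Finset.insert_erase ht]
      have htS2 : t ∉ D ∪ (T.erase t ∪ hiddenInto E H D) := by simp [htHD, htD]
      rw [hS, aux_sum_insert X _ t htS, Finset.union_insert]
      refine Finset.sum_congr rfl fun y _ => ?_
      have : ∀ s : X t, ∏ v ∈ insert t (D ∪ (T.erase t ∪ hiddenInto E H D)),
          p v (Function.update y t s) = p t (Function.update y t s) *
            ∏ v ∈ D ∪ (T.erase t ∪ hiddenInto E H D), p v y := by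
        intro s
        rw [Finset.prod_insert htS2]
        congr 1
        refine Finset.prod_congr rfl fun v hv => ?_
        have hvt : v ≠ t := fun h => htS2 (h ▸ hv)
        apply hploc
        · rw [Function.update_of_ne hvt]
        · intro u hu
          have hut : u ≠ t := by
            rintro rfl
            rcases Finset.mem_union.mp hv with h | h
            · exact hchD v h hu
            rcases Finset.mem_union.mp h with h | h
            · exact hsink v (Finset.mem_of_mem_erase h) hu
            · exact hchHD v h hu
          rw [Function.update_of_ne hut]
      rw [Finset.sum_congr rfl fun s _ => this s, ← Finset.sum_mul, hpnorm, one_mul]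
  have := key _ (H \ hiddenInto E H D) rfl Finset.sdiff_subset Finset.sdiff_disjoint
  rwa [Finset.sdiff_union_of_subset hHD] at this
end
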